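/- arXiv:1411.2647 — 6 statements merged into one kernel-verified Lean document; each statement's English description precedes it below -/
import Mathlib

section
/- A single asynchronous coordinate update preserves the invariant: for any scalar x̂ ∈ ℝ, vector r ∈ ℝⁿ, and coordinate u ∈ {1,…,n}, if x_i = x̂ + rᵀx, then setting x̂' = x̂ + r_u·z_u and r' = r − r_u·(I − Gᵀ)e_u (i.e., r'_u = G_{uu}r_u and r'_v = r_v + G_{uv}r_u for v ≠ u), one has x_i = x̂' + r'ᵀx. -/
open Matrix Finset

/-- a single asynchronous coordinate update preserves the invariant:
if `x_i = x̂ + rᵀx`, then after updating coordinate `u` via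
`x̂' = x̂ + r_u z_u` and `r' = r − r_u (I − Gᵀ) e_u`, one has `x_i = x̂' + r'ᵀx`. -/
theorem async_single_update_invariant {n : ℕ} (hn : 1 ≤ n)
    (G : Matrix (Fin n) (Fin n) ℝ) (z x : Fin n → ℝ)
    (hx : x = G *ᵥ x + z) (i : Fin n)
    (xhat : ℝ) (r : Fin n → ℝ) (u : Fin n)
    (hinv : x i = xhat + r ⬝ᵥ x) :
    x i = (xhat + r u * z u) + (r - r u • ((1 - Gᵀ) *ᵥ Pi.single u 1)) ⬝ᵥ x := by
  have hz : ((1 - Gᵀ) *ᵥ Pi.single u 1) ⬝ᵥ x = z u := by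
    have hu := congrFun hx u
    rw [Pi.add_apply] at hu
    rw [← transpose_one, ← transpose_sub, mulVec_transpose, ← dotProduct_mulVec,
      single_one_dotProduct, sub_mulVec, one_mulVec, Pi.sub_apply]
    linarith
  rw [sub_dotProduct, smul_dotProduct, hz, smul_eq_mul, hinv]
  ring
end

section
/- For every update sequence u : ℕ → {1,…,n} and every integer t ≥ 0, the asynchronous residual and estimate satisfy the invariant x_i = x̂⁽ᵗ⁾ + (r⁽ᵗ⁾)ᵀx. In particular, |x_i − x̂⁽ᵗ⁾| ≤ ‖r⁽ᵗ⁾‖₂·‖x‖₂, so if ‖r⁽ᵗ⁾‖₂ < ε then |x̂⁽ᵗ⁾ − x_i| ≤ ε‖x‖₂. -/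
open Matrix Finset

/-- Euclidean (ℓ²) norm of a vector. -/
noncomputable def l2norm {n : ℕ} (v : Fin n → ℝ) : ℝ :=
  ‖(WithLp.equiv 2 (Fin n → ℝ)).symm v‖

/-- Asynchronous residual sequence: `r⁽⁰⁾ = e_i`,
`r⁽ᵗ⁺¹⁾ = r⁽ᵗ⁾ − r⁽ᵗ⁾_{u_t} (I − Gᵀ) e_{u_t}`. -/
noncomputable def resid {n : ℕ} (G : Matrix (Fin n) (Fin n) ℝ) (i : Fin n)
    (u : ℕ → Fin n) : ℕ → Fin n → ℝ
  | 0 => Pi.single i 1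
  | t + 1 => resid G i u t - resid G i u t (u t) • ((1 - Gᵀ) *ᵥ Pi.single (u t) 1)

/-- Asynchronous estimate sequence: `x̂⁽⁰⁾ = 0`,
`x̂⁽ᵗ⁺¹⁾ = x̂⁽ᵗ⁾ + r⁽ᵗ⁾_{u_t} z_{u_t}`. -/
noncomputable def esti {n : ℕ} (G : Matrix (Fin n) (Fin n) ℝ) (i : Fin n)
    (u : ℕ → Fin n) (z : Fin n → ℝ) : ℕ → ℝ
  | 0 => 0
  | t + 1 => esti G i u z t + resid G i u t (u t) * z (u t)

/-- If `x = G x + z`, then pairing the column `(I − Gᵀ) e_k` with `x` gives `z_k`. -/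
theorem one_sub_transpose_mulVec_single_dotProduct {n : ℕ} {G : Matrix (Fin n) (Fin n) ℝ}
    {z x : Fin n → ℝ} (hx : x = G *ᵥ x + z) (k : Fin n) :
    ((1 - Gᵀ) *ᵥ Pi.single k 1) ⬝ᵥ x = z k := by
  have hk : x k = (G *ᵥ x) k + z k := congrFun hx k
  have hG : (Gᵀ *ᵥ Pi.single k 1) ⬝ᵥ x = (G *ᵥ x) k := by
    rw [mulVec_transpose, ← dotProduct_mulVec, single_one_dotProduct]
  rw [sub_mulVec, one_mulVec, sub_dotProduct, single_one_dotProduct, hG]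
  linarith

theorem eq_esti_add_resid_dotProduct {n : ℕ} {G : Matrix (Fin n) (Fin n) ℝ}
    {z x : Fin n → ℝ} (hx : x = G *ᵥ x + z) (i : Fin n) (u : ℕ → Fin n) (t : ℕ) :
    x i = esti G i u z t + resid G i u t ⬝ᵥ x := by
  induction t with
  | zero => simp [esti, resid]
  | succ t ih =>
    rw [esti, resid, sub_dotProduct, smul_dotProduct,
      one_sub_transpose_mulVec_single_dotProduct hx, smul_eq_mul, ih]
    ring

/-- Cauchy–Schwarz for the dot product. -/
theorem abs_dotProduct_le_l2norm_mul {n : ℕ} (v w : Fin n → ℝ) :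
    |v ⬝ᵥ w| ≤ l2norm v * l2norm w := by
  have h := abs_real_inner_le_norm (WithLp.toLp 2 v) (WithLp.toLp 2 w)
  rw [EuclideanSpace.inner_toLp_toLp, star_trivial, dotProduct_comm] at h
  exact h

/-- for every update sequence and every `t`, the asynchronous
invariant `x_i = x̂⁽ᵗ⁾ + (r⁽ᵗ⁾)ᵀ x` holds; in particular
`|x_i − x̂⁽ᵗ⁾| ≤ ‖r⁽ᵗ⁾‖₂ ‖x‖₂`, so `‖r⁽ᵗ⁾‖₂ < ε` implies `|x̂⁽ᵗ⁾ − x_i| ≤ ε ‖x‖₂`. -/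
theorem async_invariant {n : ℕ} (hn : 1 ≤ n)
    (G : Matrix (Fin n) (Fin n) ℝ) (z x : Fin n → ℝ)
    (hx : x = G *ᵥ x + z) (i : Fin n)
    (u : ℕ → Fin n) (t : ℕ) :
    x i = esti G i u z t + resid G i u t ⬝ᵥ x ∧
      |x i - esti G i u z t| ≤ l2norm (resid G i u t) * l2norm x ∧
      ∀ ε : ℝ, l2norm (resid G i u t) < ε →
        |esti G i u z t - x i| ≤ ε * l2norm x := by
  have hinv := eq_esti_add_resid_dotProduct hx i u t
  have hbound : |x i - esti G i u z t| ≤ l2norm (resid G i u t) * l2norm x := by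
    rw [hinv, add_sub_cancel_left]
    exact abs_dotProduct_le_l2norm_mul _ _
  refine ⟨hinv, hbound, fun ε hε => ?_⟩
  rw [abs_sub_comm]
  exact hbound.trans (mul_le_mul_of_nonneg_right hε.le (norm_nonneg _))
end

section
/- (Asymptotic convergence of the asynchronous algorithm.) Suppose the spectral radius of G̃ is strictly less than 1 (equivalently, G̃ᵏ → 0 as k → ∞), and suppose the update sequence u : ℕ → {1,…,n} visits every coordinate infinitely often (for every v, the set {t : u_t = v} is infinite). Then the asynchronous estimate converges: x̂⁽ᵗ⁾ → x_i as t → ∞. -/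
open Matrix Finset

/-- Entrywise absolute value `G̃` of a matrix. -/
noncomputable def Gabs {n : ℕ} (G : Matrix (Fin n) (Fin n) ℝ) :
    Matrix (Fin n) (Fin n) ℝ :=
  Matrix.of fun a b => |G a b|

open Filter Topology

lemma resid_succ_apply {n : ℕ} (G : Matrix (Fin n) (Fin n) ℝ) (i : Fin n) (u : ℕ → Fin n)
    (t : ℕ) (a : Fin n) :
    resid G i u (t + 1) a = resid G i u t a
      - resid G i u t (u t) * ((if a = u t then 1 else 0) - G (u t) a) := by
  simp [resid, Matrix.one_apply]

/-- The estimate plus the residual paired with the solution is conserved. -/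
lemma esti_add_resid_dotProduct {n : ℕ} (G : Matrix (Fin n) (Fin n) ℝ) (z x : Fin n → ℝ)
    (hx : x = G *ᵥ x + z) (i : Fin n) (u : ℕ → Fin n) (t : ℕ) :
    esti G i u z t + ∑ a, resid G i u t a * x a = x i := by
  induction t with
  | zero => simp [esti, resid, Pi.single_apply]
  | succ t ih =>
    have hxu : x (u t) = ∑ a, G (u t) a * x a + z (u t) := congrFun hx (u t)
    have key : ∑ a, resid G i u (t + 1) a * x a = ∑ a, resid G i u t a * x a
        - resid G i u t (u t) * (x (u t) - ∑ a, G (u t) a * x a) := by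
      simp only [resid_succ_apply, sub_mul, mul_sub, Finset.sum_sub_distrib, Finset.mul_sum]
      simp [mul_assoc]
    rw [key, esti, ← ih]
    linear_combination -resid G i u t (u t) * hxu

lemma Gabs_pow_nonneg {n : ℕ} (G : Matrix (Fin n) (Fin n) ℝ) (k : ℕ) (a b : Fin n) :
    0 ≤ (Gabs G ^ k) a b := by
  induction k generalizing b with
  | zero => rw [pow_zero, Matrix.one_apply]; split_ifs <;> norm_num
  | succ k ih =>
    rw [pow_succ, Matrix.mul_apply]
    exact Finset.sum_nonneg fun c _ => mul_nonneg (ih c) (abs_nonneg _)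

/-- If the powers of `Gabs G` tend to zero, some nonnegative weight vector is decreased by
`Gabs G` by at least `1 / 2` in every coordinate. -/
lemma exists_weight_of_tendsto_Gabs_pow {n : ℕ} (G : Matrix (Fin n) (Fin n) ℝ)
    (hρ : Tendsto (fun k : ℕ => Gabs G ^ k) atTop (𝓝 0)) :
    ∃ w : Fin n → ℝ, (∀ a, 0 ≤ w a) ∧ ∀ a, ∑ b, |G a b| * w b ≤ w a - 1 / 2 := by
  have hrow : ∀ a, Tendsto (fun k : ℕ => ((Gabs G ^ k) *ᵥ 1) a) atTop (𝓝 0) := by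
    intro a
    have h := tendsto_finsetSum Finset.univ fun b _ =>
      tendsto_pi_nhds.1 (tendsto_pi_nhds.1 hρ a) b
    simpa [Matrix.mulVec, dotProduct] using h
  obtain ⟨K, hK⟩ := (eventually_all.2 fun a =>
    (hrow a).eventually_le_const (show (0 : ℝ) < 1 / 2 by norm_num)).exists
  refine ⟨(∑ k ∈ Finset.range K, Gabs G ^ k) *ᵥ 1, fun a => ?_, fun a => ?_⟩
  · simp only [Matrix.mulVec, dotProduct, Pi.one_apply, mul_one]
    refine Finset.sum_nonneg fun b _ => ?_
    rw [Matrix.sum_apply]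
    exact Finset.sum_nonneg fun k _ => Gabs_pow_nonneg G k a b
  · have h := congrFun (congrArg (fun M => M *ᵥ (1 : Fin n → ℝ)) (mul_geom_sum (Gabs G) K)) a
    simp only [sub_mul, one_mul, Matrix.sub_mulVec, ← Matrix.mulVec_mulVec, Matrix.one_mulVec,
      Pi.sub_apply, Pi.one_apply] at h
    have hGw : ∑ b, |G a b| * ((∑ k ∈ Finset.range K, Gabs G ^ k) *ᵥ 1) b
        = (Gabs G *ᵥ ((∑ k ∈ Finset.range K, Gabs G ^ k) *ᵥ 1)) a := rfl
    rw [hGw]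
    linarith [hK a]

/-- The weighted `ℓ¹` norm of the residual decreases by at least half of the entry used. -/
lemma sum_abs_resid_succ_le {n : ℕ} (G : Matrix (Fin n) (Fin n) ℝ) (i : Fin n)
    (u : ℕ → Fin n) (w : Fin n → ℝ) (hw : ∀ a, 0 ≤ w a)
    (hGw : ∀ a, ∑ b, |G a b| * w b ≤ w a - 1 / 2) (t : ℕ) :
    ∑ a, |resid G i u (t + 1) a| * w a
      ≤ ∑ a, |resid G i u t a| * w a - |resid G i u t (u t)| / 2 := by
  have hpt : ∀ a, |resid G i u (t + 1) a| * w a ≤ |resid G i u t a| * w a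
      - (if a = u t then |resid G i u t (u t)| * w (u t) else 0)
      + |resid G i u t (u t)| * (|G (u t) a| * w a) := by
    intro a
    rw [resid_succ_apply]
    split_ifs with h
    · subst h
      rw [show ∀ r g : ℝ, r - r * (1 - g) = r * g by intros; ring, abs_mul]
      linarith
    · have h1 := abs_add_le (resid G i u t a) (resid G i u t (u t) * G (u t) a)
      rw [abs_mul] at h1
      rw [show ∀ r s g : ℝ, r - s * (0 - g) = r + s * g by intros; ring]
      linarith [mul_le_mul_of_nonneg_right h1 (hw a)]
  have hsum := Finset.sum_le_sum fun a (_ : a ∈ Finset.univ) => hpt a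
  rw [Finset.sum_add_distrib, Finset.sum_sub_distrib, ← Finset.mul_sum] at hsum
  simp only [Finset.sum_ite_eq', Finset.mem_univ, if_true] at hsum
  linarith [mul_le_mul_of_nonneg_left (hGw (u t)) (abs_nonneg (resid G i u t (u t)))]

lemma summable_abs_resid_update {n : ℕ} (G : Matrix (Fin n) (Fin n) ℝ)
    (hρ : Tendsto (fun k : ℕ => Gabs G ^ k) atTop (𝓝 0)) (i : Fin n) (u : ℕ → Fin n) :
    Summable fun t => |resid G i u t (u t)| := by
  obtain ⟨w, hw, hGw⟩ := exists_weight_of_tendsto_Gabs_pow G hρ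
  have hV : ∀ T, ∑ t ∈ Finset.range T, |resid G i u t (u t)|
      + 2 * ∑ a, |resid G i u T a| * w a ≤ 2 * ∑ a, |resid G i u 0 a| * w a := by
    intro T
    induction T with
    | zero => simp
    | succ T ih =>
      rw [Finset.sum_range_succ]
      linarith [sum_abs_resid_succ_le G i u w hw hGw T]
  refine summable_of_sum_range_le (c := 2 * ∑ a, |resid G i u 0 a| * w a)
    (fun t => abs_nonneg _) fun T => ?_
  have h0 : 0 ≤ ∑ a, |resid G i u T a| * w a :=
    Finset.sum_nonneg fun a _ => mul_nonneg (abs_nonneg _) (hw a)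
  linarith [hV T]

lemma tendsto_resid_zero {n : ℕ} (G : Matrix (Fin n) (Fin n) ℝ)
    (hρ : Tendsto (fun k : ℕ => Gabs G ^ k) atTop (𝓝 0)) (i : Fin n) (u : ℕ → Fin n)
    (a : Fin n) (hu : {t : ℕ | u t = a}.Infinite) :
    Tendsto (fun t => resid G i u t a) atTop (𝓝 0) := by
  have hc := summable_abs_resid_update G hρ i u
  have hcauchy : CauchySeq fun t => resid G i u t a := by
    refine cauchySeq_of_dist_le_of_summable _ (fun t => ?_)
      (hc.mul_right (∑ v, |(if a = v then 1 else 0) - G v a|))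
    rw [resid_succ_apply, Real.dist_eq, sub_sub_cancel, abs_mul]
    exact mul_le_mul_of_nonneg_left
      (Finset.single_le_sum (f := fun v => |(if a = v then 1 else 0) - G v a|)
        (fun v _ => abs_nonneg _) (Finset.mem_univ (u t))) (abs_nonneg _)
  obtain ⟨L, hL⟩ := cauchySeq_tendsto_of_complete hcauchy
  obtain ⟨φ, hφ, hφu⟩ := extraction_of_frequently_atTop (Nat.frequently_atTop_iff_infinite.2 hu)
  have hzero : Tendsto (fun k => resid G i u (φ k) a) atTop (𝓝 0) := by
    have h := (tendsto_zero_iff_abs_tendsto_zero _).2 hc.tendsto_atTop_zero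
    refine (h.comp hφ.tendsto_atTop).congr fun k => ?_
    simp only [Function.comp_apply, hφu k]
  rwa [tendsto_nhds_unique (hL.comp hφ.tendsto_atTop) hzero] at hL

/-- asymptotic convergence of the asynchronous algorithm:
if `ρ(G̃) < 1`, i.e. (equivalently) `G̃ᵏ → 0`, and the update sequence visits
every coordinate infinitely often, then `x̂⁽ᵗ⁾ → x_i`. -/
theorem async_asymptotic_convergence {n : ℕ} (hn : 1 ≤ n)
    (G : Matrix (Fin n) (Fin n) ℝ) (z x : Fin n → ℝ)
    (hx : x = G *ᵥ x + z) (i : Fin n)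
    (hρ : Filter.Tendsto (fun k : ℕ => Gabs G ^ k) Filter.atTop (nhds 0))
    (u : ℕ → Fin n) (hu : ∀ v : Fin n, {t : ℕ | u t = v}.Infinite) :
    Filter.Tendsto (esti G i u z) Filter.atTop (nhds (x i)) := by
  have hr : Tendsto (fun t => ∑ a, resid G i u t a * x a) atTop (𝓝 0) := by
    simpa using tendsto_finsetSum Finset.univ fun a _ =>
      (tendsto_resid_zero G hρ i u a (hu a)).mul_const (x a)
  have h := hr.const_sub (x i)
  rw [sub_zero] at h
  exact h.congr fun t => by rw [← esti_add_resid_dotProduct G z x hx i u t, add_sub_cancel_right]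
end

section
/- (Product bound, Lemma 3(b).) For every real g with 0 ≤ g < 1, all positive integers d and n, and every integer t ≥ 1: g·∏_{k=1}^{t−1} (1 − (1−g)/min(kd, n)) ≤ min( t^{−(1−g)/d}, e^{−(t−1)(1−g)/n} ). -/
open Finset

/-- If `b k ≥ m k ≥ 1` for `k ∈ s` and `0 ≤ g ≤ 1`, then `g ∏ (1 - (1 - g) / m k)` is at most
`exp (-(1 - g) ∑ 1 / b k)`. -/
theorem mul_prod_one_sub_div_le_exp {ι : Type*} (s : Finset ι) (m b : ι → ℝ) {g : ℝ}
    (hg0 : 0 ≤ g) (hg1 : g ≤ 1) (hm : ∀ k ∈ s, 1 ≤ m k) (hmb : ∀ k ∈ s, m k ≤ b k) :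
    g * ∏ k ∈ s, (1 - (1 - g) / m k) ≤ Real.exp (-(1 - g) * ∑ k ∈ s, (b k)⁻¹) := by
  have factor_nonneg : ∀ k ∈ s, 0 ≤ 1 - (1 - g) / m k := fun k hk => by
    have := div_le_self (sub_nonneg.2 hg1) (hm k hk)
    linarith
  have factor_le : ∀ k ∈ s, 1 - (1 - g) / m k ≤ Real.exp (-(1 - g) * (b k)⁻¹) := fun k hk => by
    have hpos : 0 < m k := zero_lt_one.trans_le (hm k hk)
    have hdiv : (1 - g) / b k ≤ (1 - g) / m k :=
      div_le_div_of_nonneg_left (sub_nonneg.2 hg1) hpos (hmb k hk)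
    have hexp := Real.add_one_le_exp (-(1 - g) * (b k)⁻¹)
    rw [div_eq_mul_inv _ (b k)] at hdiv
    linarith
  calc g * ∏ k ∈ s, (1 - (1 - g) / m k) ≤ ∏ k ∈ s, (1 - (1 - g) / m k) :=
        mul_le_of_le_one_left (prod_nonneg factor_nonneg) hg1
    _ ≤ ∏ k ∈ s, Real.exp (-(1 - g) * (b k)⁻¹) := prod_le_prod factor_nonneg factor_le
    _ = Real.exp (-(1 - g) * ∑ k ∈ s, (b k)⁻¹) := by rw [← Real.exp_sum, mul_sum]

/-- product bound, Lemma 3(b): for `0 ≤ g < 1`, positive integers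
`d, n`, and `t ≥ 1`:
`g ∏_{k=1}^{t−1} (1 − (1−g)/min(kd,n)) ≤ min( t^{−(1−g)/d}, e^{−(t−1)(1−g)/n} )`. -/
theorem product_bound (g : ℝ) (hg0 : 0 ≤ g) (hg1 : g < 1)
    (d n : ℕ) (hd : 0 < d) (hn : 0 < n) (t : ℕ) (ht : 1 ≤ t) :
    g * ∏ k ∈ Finset.Icc 1 (t - 1), (1 - (1 - g) / (min (k * d) n : ℕ)) ≤
      min ((t : ℝ) ^ (-(1 - g) / (d : ℝ)))
        (Real.exp (-((t : ℝ) - 1) * (1 - g) / (n : ℝ))) := by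
  have hm : ∀ k ∈ Icc 1 (t - 1), (1 : ℝ) ≤ (min (k * d) n : ℕ) := fun k hk => by
    have hk1 : 0 < k := (mem_Icc.1 hk).1
    exact_mod_cast Nat.succ_le_of_lt (lt_min (Nat.mul_pos hk1 hd) hn)
  refine le_min ?_ ?_
  · refine (mul_prod_one_sub_div_le_exp _ _ (fun k => ((k * d : ℕ) : ℝ)) hg0 hg1.le hm
      fun k _ => Nat.cast_le.2 (min_le_left _ _)).trans ?_
    rw [Real.rpow_def_of_pos (Nat.cast_pos.2 ht), Real.exp_le_exp]
    have hlog : Real.log t ≤ ∑ k ∈ Icc 1 (t - 1), (k : ℝ)⁻¹ := by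
      have h := log_add_one_le_harmonic (t - 1)
      rw [harmonic_eq_sum_Icc, Nat.sub_add_cancel ht] at h
      simpa only [Rat.cast_sum, Rat.cast_inv, Rat.cast_natCast] using h
    have hsum : ∑ k ∈ Icc 1 (t - 1), ((k * d : ℕ) : ℝ)⁻¹ =
        (∑ k ∈ Icc 1 (t - 1), (k : ℝ)⁻¹) / d := by
      simp only [Nat.cast_mul, mul_inv, div_eq_mul_inv, sum_mul]
    have hcoef : 0 ≤ (1 - g) / d := div_nonneg (sub_nonneg.2 hg1.le) d.cast_nonneg
    rw [hsum]
    calc -(1 - g) * ((∑ k ∈ Icc 1 (t - 1), (k : ℝ)⁻¹) / d)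
        = -((1 - g) / d * ∑ k ∈ Icc 1 (t - 1), (k : ℝ)⁻¹) := by ring
      _ ≤ -((1 - g) / d * Real.log t) := neg_le_neg (mul_le_mul_of_nonneg_left hlog hcoef)
      _ = Real.log t * (-(1 - g) / d) := by ring
  · refine (mul_prod_one_sub_div_le_exp _ _ (fun _ => (n : ℝ)) hg0 hg1.le hm
      fun k _ => Nat.cast_le.2 (min_le_right _ _)).trans_eq ?_
    rw [sum_const, Nat.card_Icc, Nat.add_sub_cancel, nsmul_eq_mul, Nat.cast_sub ht, Nat.cast_one]
    congr 1
    ring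
end

section
/- (Expected squared norm after one update, identity.) Let r ∈ ℝⁿ and let S ⊆ {1,…,n} with {v : r_v ≠ 0} ⊆ S and |S| = m ≥ 1. Let D be the diagonal n×n matrix with D_{uu} = ((I − G)(I − Gᵀ))_{uu} = 1 − 2G_{uu} + Σ_k G_{uk}². Then (1/m)·Σ_{u∈S} ‖r − r_u·(I − Gᵀ)e_u‖₂² = rᵀ( I − (2I − G − Gᵀ − D)/m )r. -/
open Matrix Finset

theorem l2norm_sq {n : ℕ} (v : Fin n → ℝ) : l2norm v ^ 2 = v ⬝ᵥ v := by
  rw [l2norm, EuclideanSpace.norm_sq_eq]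
  simp [dotProduct, sq]

theorem one_sub_dotProduct_self {n : ℕ} (G : Matrix (Fin n) (Fin n) ℝ) (u : Fin n) :
    (1 - G) u ⬝ᵥ (1 - G) u = 1 - 2 * G u u + ∑ k, (G u k) ^ 2 := by
  have hrow : (1 - G) u = Pi.single u 1 - G u := by
    ext k
    simp [Matrix.one_apply, Pi.single_apply, eq_comm]
  rw [hrow]
  simp only [sub_dotProduct, dotProduct_sub, single_one_dotProduct, dotProduct_single_one,
    Pi.sub_apply, Pi.single_eq_same]
  simp only [dotProduct, ← sq]
  ring

theorem l2norm_sub_smul_sq {n : ℕ} (r w : Fin n → ℝ) (c : ℝ) :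
    l2norm (r - c • w) ^ 2 = r ⬝ᵥ r - 2 * (c * (w ⬝ᵥ r)) + c * ((w ⬝ᵥ w) * c) := by
  rw [l2norm_sq]
  simp only [sub_dotProduct, dotProduct_sub, smul_dotProduct, dotProduct_smul, smul_eq_mul,
    dotProduct_comm r w]
  ring

/-- expected squared norm after one update, identity:
with `D` diagonal, `D_{uu} = ((I−G)(I−Gᵀ))_{uu} = 1 − 2G_{uu} + ∑_k G_{uk}²`,
if `supp r ⊆ S` and `|S| = m ≥ 1`, then
`(1/m) ∑_{u∈S} ‖r − r_u (I−Gᵀ)e_u‖₂² = rᵀ(I − (2I − G − Gᵀ − D)/m) r`. -/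
theorem expected_squared_norm_identity {n : ℕ} (hn : 1 ≤ n)
    (G : Matrix (Fin n) (Fin n) ℝ) (r : Fin n → ℝ)
    (S : Finset (Fin n)) (hsupp : ∀ v : Fin n, r v ≠ 0 → v ∈ S)
    (m : ℕ) (hm : 1 ≤ m) (hcard : S.card = m)
    (D : Matrix (Fin n) (Fin n) ℝ)
    (hD : D = Matrix.diagonal fun u => 1 - 2 * G u u + ∑ k, (G u k) ^ 2) :
    (∀ u : Fin n, D u u = ((1 - G) * (1 - Gᵀ)) u u) ∧
      (m : ℝ)⁻¹ * ∑ u ∈ S, l2norm (r - r u • ((1 - Gᵀ) *ᵥ Pi.single u 1)) ^ 2 =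
        r ⬝ᵥ (((1 : Matrix (Fin n) (Fin n) ℝ) -
          (m : ℝ)⁻¹ • ((2 : Matrix (Fin n) (Fin n) ℝ) - G - Gᵀ - D)) *ᵥ r) := by
  have hdiag : ∀ u, D u u = (1 - G) u ⬝ᵥ (1 - G) u := fun u => by
    rw [one_sub_dotProduct_self, hD, diagonal_apply_eq]
  have htr : (1 : Matrix (Fin n) (Fin n) ℝ) - Gᵀ = (1 - G)ᵀ := by simp
  refine ⟨fun u => by rw [hdiag, htr]; rfl, ?_⟩
  have hm0 : (m : ℝ) ≠ 0 := by positivity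
  have hterm : ∀ u, l2norm (r - r u • ((1 - Gᵀ) *ᵥ Pi.single u 1)) ^ 2 =
      r ⬝ᵥ r - 2 * (r u * ((1 - G) *ᵥ r) u) + r u * (D *ᵥ r) u := fun u => by
    have hw : (1 - Gᵀ) *ᵥ Pi.single u 1 = (1 - G) u := by
      rw [htr, mulVec_single_one]
      rfl
    have hDr : (D *ᵥ r) u = D u u * r u := by
      rw [hD, mulVec_diagonal, diagonal_apply_eq]
    rw [hw, l2norm_sub_smul_sq, hDr, hdiag]
    rfl
  have hext : ∀ f : Fin n → ℝ, ∑ u ∈ S, r u * f u = r ⬝ᵥ f := fun f =>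
    sum_subset (subset_univ S) fun u _ hu => by
      rw [not_not.mp (mt (hsupp u) hu), zero_mul]
  have hG : r ⬝ᵥ (Gᵀ *ᵥ r) = r ⬝ᵥ (G *ᵥ r) := by
    rw [mulVec_transpose, dotProduct_comm, dotProduct_mulVec]
  have htwo : (2 : Matrix (Fin n) (Fin n) ℝ) *ᵥ r = (2 : ℝ) • r := by
    rw [← one_add_one_eq_two, add_mulVec, one_mulVec, two_smul]
  rw [sum_congr rfl fun u _ => hterm u]
  simp only [sum_add_distrib, sum_sub_distrib, ← mul_sum, hext, sum_const, hcard,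
    nsmul_eq_mul, sub_mulVec, smul_mulVec, one_mulVec, htwo, dotProduct_sub, dotProduct_smul,
    smul_eq_mul, hG]
  field_simp
  ring
end

section
/- (Weighted-sum bound, exponential branch of Lemma 4.) Let g ∈ [0,1) be real and let d ≥ 4 and n ≥ 8 be integers. For m ≥ 1 define a_m = ((1+g)²/min(md, n))·(1 + 1/min(md, n)). Then for every integer t ≥ 1: Σ_{k=1}^{t} ( ∏_{m=k+1}^{t} a_m )·e^{−2k(1−g)/n} ≤ 4·e^{−2t(1−g)/n}. -/
open Finset

/-- If `a (k + 1) * e k ≤ 3 / 4 * e (k + 1)` for `k ≥ 1`, the weighted sums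
`∑ k ∈ [1, t], (∏ m ∈ [k + 1, t], a m) * e k` are bounded by `4 * e t`. -/
theorem sum_prod_mul_le_four_mul {a e : ℕ → ℝ} (ha : ∀ m, 0 ≤ a m) (he : 0 ≤ e 1)
    (h : ∀ k, 1 ≤ k → a (k + 1) * e k ≤ 3 / 4 * e (k + 1)) {t : ℕ} (ht : 1 ≤ t) :
    ∑ k ∈ Finset.Icc 1 t, (∏ m ∈ Finset.Icc (k + 1) t, a m) * e k ≤ 4 * e t := by
  induction t, ht using Nat.le_induction with
  | base => simp; linarith
  | succ t ht ih =>
    have hsum : ∑ k ∈ Finset.Icc 1 t, (∏ m ∈ Finset.Icc (k + 1) (t + 1), a m) * e k =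
        a (t + 1) * ∑ k ∈ Finset.Icc 1 t, (∏ m ∈ Finset.Icc (k + 1) t, a m) * e k := by
      rw [Finset.mul_sum]
      refine Finset.sum_congr rfl fun k hk => ?_
      rw [Finset.prod_Icc_succ_top (by have := (Finset.mem_Icc.1 hk).2; omega)]
      ring
    rw [Finset.sum_Icc_succ_top (by omega), hsum,
      Finset.Icc_eq_empty (show ¬t + 1 + 1 ≤ t + 1 by omega),
      Finset.prod_empty, one_mul]
    linarith [mul_le_mul_of_nonneg_left ih (ha (t + 1)), h t ht]

theorem one_add_sq_div_mul_exp_le {g x y : ℝ} (hg0 : 0 ≤ g) (hg1 : g < 1) (hx : 8 ≤ x)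
    (hy : 8 ≤ y) :
    (1 + g) ^ 2 / x * (1 + 1 / x) * Real.exp (2 * (1 - g) / y) ≤ 3 / 4 := by
  have hexp : Real.exp (2 * (1 - g) / y) ≤ 4 / 3 := by
    have hle : 2 * (1 - g) / y ≤ 1 / 4 := by
      rw [div_le_iff₀ (by linarith)]
      linarith
    have hinv : 3 / 4 ≤ Real.exp (-(2 * (1 - g) / y)) := by
      linarith [Real.add_one_le_exp (-(2 * (1 - g) / y))]
    rw [Real.exp_neg] at hinv
    have := inv_anti₀ (by norm_num) hinv
    rw [inv_inv] at this
    linarith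
  calc (1 + g) ^ 2 / x * (1 + 1 / x) * Real.exp (2 * (1 - g) / y)
      ≤ (1 + 1) ^ 2 / 8 * (1 + 1 / 8) * (4 / 3) := by gcongr
    _ = 3 / 4 := by norm_num

/-- weighted-sum bound, exponential branch of Lemma 4: for
`g ∈ [0,1)`, integers `d ≥ 4`, `n ≥ 8`, and
`a_m = ((1+g)²/min(md,n))(1 + 1/min(md,n))`, for every `t ≥ 1`:
`∑_{k=1}^{t} (∏_{m=k+1}^{t} a_m) e^{−2k(1−g)/n} ≤ 4 e^{−2t(1−g)/n}`. -/
theorem weighted_sum_bound_exponential (g : ℝ) (hg0 : 0 ≤ g) (hg1 : g < 1)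
    (d n : ℕ) (hd : 4 ≤ d) (hn : 8 ≤ n) (t : ℕ) (ht : 1 ≤ t) :
    ∑ k ∈ Finset.Icc 1 t,
        (∏ m ∈ Finset.Icc (k + 1) t,
            ((1 + g) ^ 2 / (min (m * d) n : ℕ) * (1 + 1 / (min (m * d) n : ℕ)))) *
          Real.exp (-(2 * (k : ℝ) * (1 - g)) / (n : ℝ)) ≤
      4 * Real.exp (-(2 * (t : ℝ) * (1 - g)) / (n : ℝ)) := by
  refine sum_prod_mul_le_four_mul
    (a := fun m => (1 + g) ^ 2 / (min (m * d) n : ℕ) * (1 + 1 / (min (m * d) n : ℕ)))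
    (e := fun k => Real.exp (-(2 * (k : ℝ) * (1 - g)) / (n : ℝ)))
    (fun m => by positivity) (Real.exp_pos _).le (fun k hk => ?_) ht
  have hmin : (8 : ℝ) ≤ (min ((k + 1) * d) n : ℕ) := by
    exact_mod_cast le_min (by nlinarith) hn
  have hstep : Real.exp (-(2 * (k : ℝ) * (1 - g)) / n) =
      Real.exp (2 * (1 - g) / n) * Real.exp (-(2 * ((k + 1 : ℕ) : ℝ) * (1 - g)) / n) := by
    rw [← Real.exp_add]
    congr 1
    push_cast
    ring
  rw [hstep, ← mul_assoc]
  exact mul_le_mul_of_nonneg_right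
    (one_add_sq_div_mul_exp_le hg0 hg1 hmin (by exact_mod_cast hn)) (Real.exp_pos _).le
end
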